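/- Let m ∈ ℕ, let I : (0,∞) → (0,∞) be non-decreasing, and let ‖·‖_Y be a rearrangement-invariant Banach function norm on measurable functions on (0,∞) with associate norm ‖·‖_{Y'}. Then for every non-negative measurable f on (0,∞), ‖H_I^m f‖_Y = sup{ ∫_0^∞ f(t) · R_I^m g*(t) dt : ‖g‖_{Y'} ≤ 1 }. -/

import Mathlib

open MeasureTheory Set Filter
open scoped ENNReal NNReal Topology

noncomputable section

/-- The distribution function of `f`, viewed as a function on `(0,∞)` with Lebesgue measure:
`μ_f(s) = λ({t ∈ (0,∞) : f(t) > s})`. -/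
def distrib (f : ℝ → ℝ≥0∞) (s : ℝ≥0∞) : ℝ≥0∞ :=
  volume {t : ℝ | t ∈ Set.Ioi (0 : ℝ) ∧ s < f t}

/-- The non-increasing rearrangement `f*(t) = inf { s ≥ 0 : μ_f(s) ≤ t }`. -/
def rearr (f : ℝ → ℝ≥0∞) (t : ℝ) : ℝ≥0∞ :=
  sInf {s : ℝ≥0∞ | distrib f s ≤ ENNReal.ofReal t}

/-- The operator `R_I f(t) = (1/I(t)) ∫_0^t f(s) ds`. -/
def RI (I : ℝ → ℝ) (f : ℝ → ℝ≥0∞) : ℝ → ℝ≥0∞ :=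
  fun t => (∫⁻ s in Set.Ioc (0 : ℝ) t, f s) / ENNReal.ofReal (I t)

/-- The operator `H_I f(t) = ∫_t^∞ f(s)/I(s) ds`. -/
def HI (I : ℝ → ℝ) (f : ℝ → ℝ≥0∞) : ℝ → ℝ≥0∞ :=
  fun t => ∫⁻ s in Set.Ioi t, f s / ENNReal.ofReal (I s)

/-- `G_I^m f(t) = sup_{s ≥ t} R_I^m f*(s)`. -/
def GI (I : ℝ → ℝ) (m : ℕ) (f : ℝ → ℝ≥0∞) : ℝ → ℝ≥0∞ :=
  fun t => ⨆ s ∈ Set.Ici t, (RI I)^[m] (rearr f) s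

/-- `Φ_I^m(t,s) = (∫_s^t 1/I(τ) dτ)^(m-1) / I(t)`. -/
def Phi (I : ℝ → ℝ) (m : ℕ) (t s : ℝ) : ℝ :=
  (∫ τ in s..t, 1 / I τ) ^ (m - 1) / I t

/-- `Φ_I^m(t,s)` is essentially decreasing in `t`. -/
def EssentiallyDecreasingIn (I : ℝ → ℝ) (m : ℕ) : Prop :=
  ∀ s₀ ∈ Set.Ioi (0 : ℝ), ∃ t₀ ∈ Set.Ioi (0 : ℝ), ∀ t ∈ Set.Ioi t₀,
    ∃ rt ∈ Set.Ioi (0 : ℝ), ∀ r ∈ Set.Ioi rt, ∀ s ∈ Set.Ioo (0 : ℝ) s₀,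
      Phi I m r s ≤ Phi I m t s

/-- The kernel operator `f ↦ (t ↦ ∫_t^∞ (f(s)/I(s)) (∫_t^s 1/I(r) dr)^(m-1) ds)`. -/
def kernelOp (I : ℝ → ℝ) (m : ℕ) (f : ℝ → ℝ≥0∞) : ℝ → ℝ≥0∞ :=
  fun t => ∫⁻ s in Set.Ioi t,
    (f s / ENNReal.ofReal (I s)) * (ENNReal.ofReal (∫ r in t..s, 1 / I r)) ^ (m - 1)

/-- A Banach function norm on (non-negative) measurable functions on `(0,∞)`
(with Lebesgue measure). -/
structure BanachFunctionNorm where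
  /-- The norm functional. -/
  N : (ℝ → ℝ≥0∞) → ℝ≥0∞
  /-- Positive homogeneity. -/
  smul : ∀ (c : ℝ≥0) (f : ℝ → ℝ≥0∞), Measurable f →
    N (fun t => (c : ℝ≥0∞) * f t) = (c : ℝ≥0∞) * N f
  /-- The norm vanishes exactly on a.e.-zero functions. -/
  eq_zero_iff : ∀ f : ℝ → ℝ≥0∞, Measurable f →
    (N f = 0 ↔ ∀ᵐ t ∂(volume.restrict (Set.Ioi (0 : ℝ))), f t = 0)
  /-- Subadditivity. -/
  add_le : ∀ f g : ℝ → ℝ≥0∞, Measurable f → Measurable g →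
    N (fun t => f t + g t) ≤ N f + N g
  /-- The lattice property. -/
  mono : ∀ f g : ℝ → ℝ≥0∞, Measurable f → Measurable g →
    (∀ᵐ t ∂(volume.restrict (Set.Ioi (0 : ℝ))), f t ≤ g t) → N f ≤ N g
  /-- The Fatou property: `f_n ↑ f` a.e. implies `‖f_n‖ ↑ ‖f‖`. -/
  fatou : ∀ (f : ℕ → ℝ → ℝ≥0∞) (g : ℝ → ℝ≥0∞), (∀ n, Measurable (f n)) →
    Measurable g →
    (∀ᵐ t ∂(volume.restrict (Set.Ioi (0 : ℝ))), Monotone fun n => f n t) →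
    (∀ᵐ t ∂(volume.restrict (Set.Ioi (0 : ℝ))), g t = ⨆ n, f n t) →
    N g = ⨆ n, N (f n)
  /-- Characteristic functions of sets of finite measure have finite norm. -/
  indicator_lt_top : ∀ E : Set ℝ, MeasurableSet E → E ⊆ Set.Ioi (0 : ℝ) →
    volume E < ∞ → N (E.indicator 1) < ∞
  /-- Local embedding into `L¹`. -/
  exists_integral_le : ∀ E : Set ℝ, MeasurableSet E → E ⊆ Set.Ioi (0 : ℝ) →
    volume E < ∞ → ∃ C : ℝ≥0∞, C ≠ ∞ ∧
      ∀ f : ℝ → ℝ≥0∞, Measurable f → ∫⁻ t in E, f t ≤ C * N f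

/-- A rearrangement-invariant Banach function norm: equimeasurable functions have
equal norms. -/
structure RIBanachFunctionNorm extends BanachFunctionNorm where
  /-- Rearrangement invariance. -/
  ri : ∀ f g : ℝ → ℝ≥0∞, Measurable f → Measurable g →
    (∀ s, distrib f s = distrib g s) → N f = N g

/-- The associate norm `‖f‖_{X'} = sup { ∫_0^∞ |f g| : ‖g‖_X ≤ 1 }`. -/
def assocNorm (X : RIBanachFunctionNorm) (f : ℝ → ℝ≥0∞) : ℝ≥0∞ :=
  ⨆ (g : ℝ → ℝ≥0∞) (_ : Measurable g) (_ : X.N g ≤ 1),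
    ∫⁻ t in Set.Ioi (0 : ℝ), f t * g t

/-- The down-associate norm `‖f‖_{X'_d} = sup { ∫_0^∞ |f| g* : ‖g‖_X ≤ 1 }`. -/
def downAssocNorm (X : RIBanachFunctionNorm) (f : ℝ → ℝ≥0∞) : ℝ≥0∞ :=
  ⨆ (g : ℝ → ℝ≥0∞) (_ : Measurable g) (_ : X.N g ≤ 1),
    ∫⁻ t in Set.Ioi (0 : ℝ), f t * rearr g t
lemma distrib_anti (f : ℝ → ℝ≥0∞) : Antitone (distrib f) := fun _ _ h =>
  measure_mono fun _ ht => ⟨ht.1, h.trans_lt ht.2⟩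

/-- The distribution function is right-continuous, so the infimum defining `f*` is attained. -/
lemma distrib_rearr_le (f : ℝ → ℝ≥0∞) (t : ℝ) :
    distrib f (rearr f t) ≤ ENNReal.ofReal t := by
  have hne : {s : ℝ≥0∞ | distrib f s ≤ ENNReal.ofReal t}.Nonempty :=
    ⟨∞, by simp [distrib]⟩
  obtain ⟨u, hu_anti, hu_lim, hu_mem⟩ := exists_seq_tendsto_sInf hne (OrderBot.bddBelow _)
  have hset : {x : ℝ | x ∈ Ioi (0 : ℝ) ∧ rearr f t < f x} =
      ⋃ n, {x : ℝ | x ∈ Ioi (0 : ℝ) ∧ u n < f x} := by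
    ext x
    simp only [mem_ofPred_eq, mem_iUnion]
    constructor
    · rintro ⟨hx, hlt⟩
      obtain ⟨n, hn⟩ := (hu_lim.eventually_lt_const hlt).exists
      exact ⟨n, hx, hn⟩
    · rintro ⟨n, hx, hn⟩
      exact ⟨hx, (sInf_le (hu_mem n)).trans_lt hn⟩
  have hmono : Monotone fun n => {x : ℝ | x ∈ Ioi (0 : ℝ) ∧ u n < f x} :=
    fun _ _ h _ hx => ⟨hx.1, (hu_anti h).trans_lt hx.2⟩
  rw [distrib, hset, hmono.measure_iUnion]
  exact iSup_le hu_mem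

lemma rearr_le_of_distrib_le {f : ℝ → ℝ≥0∞} {s : ℝ≥0∞} {t : ℝ}
    (h : distrib f s ≤ ENNReal.ofReal t) : rearr f t ≤ s := sInf_le h

lemma lt_distrib_of_lt_rearr {f : ℝ → ℝ≥0∞} {s : ℝ≥0∞} {t : ℝ}
    (h : s < rearr f t) : ENNReal.ofReal t < distrib f s := by
  by_contra! hc
  exact h.not_ge (rearr_le_of_distrib_le hc)

lemma lt_rearr_of_lt_distrib {f : ℝ → ℝ≥0∞} {s : ℝ≥0∞} {t : ℝ}
    (h : ENNReal.ofReal t < distrib f s) : s < rearr f t := by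
  by_contra! hc
  exact h.not_ge ((distrib_anti f hc).trans (distrib_rearr_le f t))

lemma rearr_anti (f : ℝ → ℝ≥0∞) : Antitone (rearr f) := fun _ _ h =>
  sInf_le_sInf fun _ hs => le_trans hs (ENNReal.ofReal_le_ofReal h)

lemma HI_anti (I : ℝ → ℝ) (f : ℝ → ℝ≥0∞) : Antitone (HI I f) := fun _ _ h =>
  lintegral_mono_set (Ioi_subset_Ioi h)

lemma measurable_HI (I : ℝ → ℝ) (f : ℝ → ℝ≥0∞) : Measurable (HI I f) :=
  (HI_anti I f).measurable

lemma measurable_HI_iterate (I : ℝ → ℝ) {f : ℝ → ℝ≥0∞} (hf : Measurable f) (m : ℕ) :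
    Measurable ((HI I)^[m] f) := by
  cases m with
  | zero => exact hf
  | succ m => rw [Function.iterate_succ_apply']; exact measurable_HI _ _

lemma aemeasurable_ofReal_of_monotoneOn {I : ℝ → ℝ} (hI : MonotoneOn I (Ioi 0)) :
    AEMeasurable (fun t => ENNReal.ofReal (I t)) (volume.restrict (Ioi (0 : ℝ))) :=
  (aemeasurable_restrict_of_monotoneOn measurableSet_Ioi hI).ennreal_ofReal

lemma aemeasurable_RI {I : ℝ → ℝ} (hI : MonotoneOn I (Ioi 0)) (φ : ℝ → ℝ≥0∞) :
    AEMeasurable (RI I φ) (volume.restrict (Ioi (0 : ℝ))) := by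
  have hmono : Monotone fun t : ℝ => ∫⁻ s in Ioc (0 : ℝ) t, φ s := fun _ _ h =>
    lintegral_mono_set (Ioc_subset_Ioc_right h)
  exact hmono.measurable.aemeasurable.div (aemeasurable_ofReal_of_monotoneOn hI)

/-- `R_I` and `H_I` are adjoint to each other. -/
lemma lintegral_mul_RI {I : ℝ → ℝ} (hI : MonotoneOn I (Ioi 0)) {f φ : ℝ → ℝ≥0∞}
    (hf : AEMeasurable f (volume.restrict (Ioi (0 : ℝ))))
    (hφ : AEMeasurable φ (volume.restrict (Ioi (0 : ℝ)))) :
    ∫⁻ t in Ioi (0 : ℝ), f t * RI I φ t = ∫⁻ t in Ioi (0 : ℝ), HI I f t * φ t := by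
  have hJ := aemeasurable_ofReal_of_monotoneOn hI
  have hF : AEMeasurable (fun t => f t / ENNReal.ofReal (I t)) (volume.restrict (Ioi (0 : ℝ))) :=
    hf.div hJ
  have hpair : AEMeasurable (fun p : ℝ × ℝ =>
      {q : ℝ × ℝ | q.2 ≤ q.1}.indicator
        (fun q => f q.1 / ENNReal.ofReal (I q.1) * φ q.2) p)
      ((volume.restrict (Ioi (0 : ℝ))).prod (volume.restrict (Ioi (0 : ℝ)))) := by
    refine AEMeasurable.indicator ?_ (measurableSet_le measurable_snd measurable_fst)
    exact hF.comp_fst.mul hφ.comp_snd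
  calc ∫⁻ t in Ioi (0 : ℝ), f t * RI I φ t
      = ∫⁻ t in Ioi (0 : ℝ), ∫⁻ s in Ioi (0 : ℝ), {q : ℝ × ℝ | q.2 ≤ q.1}.indicator
        (fun q => f q.1 / ENNReal.ofReal (I q.1) * φ q.2) (t, s) := by
        refine lintegral_congr fun t => ?_
        have h1 : ∀ s, {q : ℝ × ℝ | q.2 ≤ q.1}.indicator
            (fun q => f q.1 / ENNReal.ofReal (I q.1) * φ q.2) (t, s) =
            (Iic t).indicator (fun s => f t / ENNReal.ofReal (I t) * φ s) s := fun s => rfl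
        simp_rw [h1]
        rw [lintegral_indicator measurableSet_Iic, Measure.restrict_restrict measurableSet_Iic,
          lintegral_const_mul'' _ (hφ.mono_measure
            (Measure.restrict_mono inter_subset_right le_rfl)), inter_comm, Ioi_inter_Iic, RI,
          div_eq_mul_inv, div_eq_mul_inv]
        ring
    _ = ∫⁻ s in Ioi (0 : ℝ), ∫⁻ t in Ioi (0 : ℝ), {q : ℝ × ℝ | q.2 ≤ q.1}.indicator
        (fun q => f q.1 / ENNReal.ofReal (I q.1) * φ q.2) (t, s) :=
        lintegral_lintegral_swap hpair
    _ = ∫⁻ t in Ioi (0 : ℝ), HI I f t * φ t := by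
        refine setLIntegral_congr_fun measurableSet_Ioi fun s hs => ?_
        have h1 : ∀ t, {q : ℝ × ℝ | q.2 ≤ q.1}.indicator
            (fun q => f q.1 / ENNReal.ofReal (I q.1) * φ q.2) (t, s) =
            (Ici s).indicator (fun t => f t / ENNReal.ofReal (I t) * φ s) t := fun t => rfl
        simp_rw [h1]
        have h2 : Ici s ∩ Ioi (0 : ℝ) = Ici s :=
          inter_eq_left.2 fun x hx => lt_of_lt_of_le (mem_Ioi.1 hs) (mem_Ici.1 hx)
        rw [lintegral_indicator measurableSet_Ici, Measure.restrict_restrict measurableSet_Ici,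
          h2, lintegral_mul_const'' _ (hF.mono_measure
            (Measure.restrict_mono (h2 ▸ inter_subset_right) le_rfl)), HI,
          setLIntegral_congr Ioi_ae_eq_Ici]

lemma lintegral_mul_RI_iterate {I : ℝ → ℝ} (hI : MonotoneOn I (Ioi 0)) {f φ : ℝ → ℝ≥0∞}
    (hf : Measurable f) (hφ : Measurable φ) (m : ℕ) :
    ∫⁻ t in Ioi (0 : ℝ), f t * (RI I)^[m] φ t =
      ∫⁻ t in Ioi (0 : ℝ), (HI I)^[m] f t * φ t := by
  induction m generalizing f with
  | zero => rfl
  | succ m ih =>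
    have hφm : AEMeasurable ((RI I)^[m] φ) (volume.restrict (Ioi (0 : ℝ))) := by
      cases m with
      | zero => exact hφ.aemeasurable
      | succ m => rw [Function.iterate_succ_apply']; exact aemeasurable_RI hI _
    rw [Function.iterate_succ_apply', lintegral_mul_RI hI hf.aemeasurable hφm,
      ih (measurable_HI I f), Function.iterate_succ_apply]

lemma volume_Ioi_ofReal_lt (a : ℝ≥0∞) :
    volume {r : ℝ | r ∈ Ioi (0 : ℝ) ∧ ENNReal.ofReal r < a} = a := by
  rcases eq_or_ne a ∞ with rfl | ha
  · have : {r : ℝ | r ∈ Ioi (0 : ℝ) ∧ ENNReal.ofReal r < ∞} = Ioi 0 := by ext; simp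
    rw [this, Real.volume_Ioi]
  · have : {r : ℝ | r ∈ Ioi (0 : ℝ) ∧ ENNReal.ofReal r < a} = Ioo 0 a.toReal := by
      ext r
      simp only [mem_ofPred_eq, mem_Ioi, mem_Ioo]
      refine and_congr_right fun hr => ?_
      rw [ENNReal.ofReal_lt_iff_lt_toReal hr.le ha]
    rw [this, Real.volume_Ioo, sub_zero, ENNReal.ofReal_toReal ha]

/-- The layer cake formula for functions with values in `[0,∞]`. -/
lemma setLIntegral_eq_lintegral_superlevel {g : ℝ → ℝ≥0∞} (hg : Measurable g) (E : Set ℝ) :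
    ∫⁻ t in E, g t =
      ∫⁻ r in Ioi (0 : ℝ), volume.restrict E {t | ENNReal.ofReal r < g t} := by
  have hm : MeasurableSet {p : ℝ × ℝ | ENNReal.ofReal p.2 < g p.1} :=
    measurableSet_lt (ENNReal.measurable_ofReal.comp measurable_snd) (hg.comp measurable_fst)
  have h1 := Measure.prod_apply (μ := volume.restrict E)
    (ν := volume.restrict (Ioi (0 : ℝ))) hm
  rw [Measure.prod_apply_symm hm] at h1
  refine Eq.trans (lintegral_congr fun t => ?_) h1.symm
  rw [Measure.restrict_apply (measurable_prodMk_left hm), ← volume_Ioi_ofReal_lt (g t)]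
  congr 1
  ext r
  simp [and_comm]

/-- The Hardy–Littlewood inequality for initial intervals. -/
lemma setLIntegral_Ioc_le_rearr {g : ℝ → ℝ≥0∞} (hg : Measurable g) (s : ℝ) :
    ∫⁻ t in Ioc (0 : ℝ) s, g t ≤ ∫⁻ t in Ioc (0 : ℝ) s, rearr g t := by
  rw [setLIntegral_eq_lintegral_superlevel hg,
    setLIntegral_eq_lintegral_superlevel (rearr_anti g).measurable]
  refine lintegral_mono fun r => ?_
  rw [Measure.restrict_apply (measurableSet_lt measurable_const hg),
    Measure.restrict_apply (measurableSet_lt measurable_const (rearr_anti g).measurable)]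
  have hlow : volume ({t : ℝ | t ∈ Ioi (0 : ℝ) ∧
      ENNReal.ofReal t < min (ENNReal.ofReal s) (distrib g (ENNReal.ofReal r))}) ≤
      volume ({t | ENNReal.ofReal r < rearr g t} ∩ Ioc 0 s) := by
    refine measure_mono fun t ht => ?_
    obtain ⟨ht0, ht1⟩ := ht
    rw [lt_min_iff] at ht1
    refine ⟨lt_rearr_of_lt_distrib ht1.2, ht0, ?_⟩
    exact ((ENNReal.ofReal_lt_ofReal_iff_of_nonneg (le_of_lt ht0)).1 ht1.1).le
  rw [volume_Ioi_ofReal_lt] at hlow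
  refine le_trans (le_min ?_ ?_) hlow
  · refine (measure_mono inter_subset_right).trans ?_
    simp
  · exact measure_mono fun t ht => ⟨ht.2.1, ht.1⟩

lemma lintegral_HI_mul_le {I : ℝ → ℝ} (hI : MonotoneOn I (Ioi 0)) {f g : ℝ → ℝ≥0∞}
    (hf : Measurable f) (hg : Measurable g) :
    ∫⁻ t in Ioi (0 : ℝ), HI I f t * g t ≤ ∫⁻ t in Ioi (0 : ℝ), HI I f t * rearr g t := by
  rw [← lintegral_mul_RI hI hf.aemeasurable hg.aemeasurable,
    ← lintegral_mul_RI hI hf.aemeasurable (rearr_anti g).measurable.aemeasurable]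
  exact lintegral_mono fun t => mul_le_mul_right
    (ENNReal.div_le_div_right (setLIntegral_Ioc_le_rearr hg t) _) _

lemma volume_inter_initial {F : Set ℝ} (hF : F ⊆ Ioi 0) {a : ℝ≥0∞} (ha : a ≤ volume F) :
    volume (F ∩ {x | volume (F ∩ Iic x) ≤ a}) = a := by
  have hmono : Monotone fun x => volume (F ∩ Iic x) := fun _ _ h =>
    measure_mono (inter_subset_inter_right _ (Iic_subset_Iic.2 h))
  have hlip : ∀ x y, volume (F ∩ Iic y) ≤ volume (F ∩ Iic x) + ENNReal.ofReal (y - x) := by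
    intro x y
    rw [← Real.volume_Ioc]
    refine (measure_mono fun z hz => ?_).trans (measure_union_le _ _)
    rcases le_or_gt z x with h | h
    · exact Or.inl ⟨hz.1, h⟩
    · exact Or.inr ⟨h, hz.2⟩
  rcases ha.eq_or_lt with rfl | ha
  · exact congrArg volume (inter_eq_left.2 fun _ _ => measure_mono inter_subset_left)
  have hF' : F = ⋃ n : ℕ, F ∩ Iic (n : ℝ) := by
    rw [← inter_iUnion, iUnion_Iic_of_not_bddAbove_range, inter_univ]
    rintro ⟨b, hb⟩
    obtain ⟨n, hn⟩ := exists_nat_gt b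
    exact hn.not_ge (hb ⟨n, rfl⟩)
  obtain ⟨n, hn⟩ : ∃ n : ℕ, a < volume (F ∩ Iic (n : ℝ)) := by
    have hmono' : Monotone fun n : ℕ => F ∩ Iic (n : ℝ) := fun _ _ h =>
      inter_subset_inter_right _ (Iic_subset_Iic.2 (Nat.cast_le.2 h))
    rw [hF', hmono'.measure_iUnion] at ha
    exact lt_iSup_iff.1 ha
  set S : Set ℝ := {x | volume (F ∩ Iic x) ≤ a} with hS
  have hbdd : BddAbove S := ⟨n, fun x hx => by
    by_contra! h
    exact (hn.trans_le ((hmono h.le).trans hx)).false⟩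
  have hne : S.Nonempty := ⟨0, by
    have : F ∩ Iic (0 : ℝ) = ∅ := by
      ext x
      simp only [mem_inter_iff, mem_Iic, mem_empty_iff_false, iff_false, not_and, not_le]
      exact fun hx => hF hx
    simp [hS, this]⟩
  set c := sSup S with hc
  have hle : volume (F ∩ Iic c) ≤ a := by
    refine ENNReal.le_of_forall_pos_le_add fun ε hε _ => ?_
    obtain ⟨x, hxS, hx⟩ := exists_lt_of_lt_csSup hne (sub_lt_self c (NNReal.coe_pos.2 hε))
    refine (hlip x c).trans (add_le_add hxS ?_)
    rw [← ENNReal.ofReal_coe_nnreal]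
    exact ENNReal.ofReal_le_ofReal (by linarith)
  have hge : a ≤ volume (F ∩ Iic c) := by
    refine ENNReal.le_of_forall_pos_le_add fun ε hε _ => ?_
    have hx : c + ε ∉ S := notMem_of_csSup_lt (lt_add_of_pos_right c (NNReal.coe_pos.2 hε)) hbdd
    have hx' : a < volume (F ∩ Iic (c + ε)) := not_le.1 hx
    refine hx'.le.trans ((hlip c _).trans ?_)
    rw [add_sub_cancel_left, ENNReal.ofReal_coe_nnreal]
  have hSc : S = Iic c := by
    ext x
    exact ⟨fun hx => le_csSup hbdd hx, fun hx => (hmono hx).trans hle⟩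
  rw [hSc]
  exact le_antisymm hle hge

/-- The position of `x` when `(0,∞)` is sorted by decreasing values of `g`, ties being broken from
left to right. -/
def decreasingRank (g : ℝ → ℝ≥0∞) (x : ℝ) : ℝ≥0∞ :=
  volume {y : ℝ | y ∈ Ioi (0 : ℝ) ∧ (g x < g y ∨ g y = g x ∧ y ≤ x)}

lemma distrib_le_decreasingRank (g : ℝ → ℝ≥0∞) (x : ℝ) :
    distrib g (g x) ≤ decreasingRank g x :=
  measure_mono fun _ hy => ⟨hy.1, Or.inl hy.2⟩

lemma decreasingRank_lt_top {g : ℝ → ℝ≥0∞} (hg : distrib g 0 < ∞) (x : ℝ) :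
    decreasingRank g x < ∞ := by
  have hsub : {y : ℝ | y ∈ Ioi (0 : ℝ) ∧ (g x < g y ∨ g y = g x ∧ y ≤ x)} ⊆
      {y : ℝ | y ∈ Ioi (0 : ℝ) ∧ 0 < g y} ∪ Ioc 0 x := by
    rintro y ⟨hy0, hy | hy⟩
    · exact Or.inl ⟨hy0, pos_of_gt hy⟩
    · exact Or.inr ⟨hy0, hy.2⟩
  refine (measure_mono hsub).trans_lt ((measure_union_le _ _).trans_lt ?_)
  exact ENNReal.add_lt_top.2 ⟨hg, measure_Ioc_lt_top⟩

lemma distrib_lt_top {g : ℝ → ℝ≥0∞} (hg : distrib g 0 < ∞) (s : ℝ≥0∞) : distrib g s < ∞ :=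
  (distrib_anti g zero_le).trans_lt hg

lemma ofReal_le_volume_rearr_le {g : ℝ → ℝ≥0∞} (hgm : Measurable g) (hg : distrib g 0 < ∞)
    (t : ℝ) : ENNReal.ofReal t ≤ volume {x : ℝ | x ∈ Ioi (0 : ℝ) ∧ rearr g t ≤ g x} := by
  rcases eq_or_ne (rearr g t) 0 with h0 | h0
  · have : {x : ℝ | x ∈ Ioi (0 : ℝ) ∧ rearr g t ≤ g x} = Ioi 0 := by ext; simp [h0]
    rw [this, Real.volume_Ioi]
    exact le_top
  · obtain ⟨r, hr_mono, hr_lt, hr_lim⟩ := exists_seq_strictMono_tendsto' (pos_iff_ne_zero.2 h0)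
    have hset : {x : ℝ | x ∈ Ioi (0 : ℝ) ∧ rearr g t ≤ g x} =
        ⋂ n, {x : ℝ | x ∈ Ioi (0 : ℝ) ∧ r n < g x} := by
      ext x
      simp only [mem_ofPred_eq, mem_iInter]
      refine ⟨fun hx n => ⟨hx.1, (hr_lt n).2.trans_le hx.2⟩, fun hx => ⟨(hx 0).1, ?_⟩⟩
      exact le_of_tendsto' hr_lim fun n => (hx n).2.le
    have hlim := tendsto_measure_iInter_atTop (μ := volume)
      (s := fun n => {x : ℝ | x ∈ Ioi (0 : ℝ) ∧ r n < g x})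
      (fun n => (measurableSet_Ioi.inter
        (measurableSet_lt measurable_const hgm)).nullMeasurableSet)
      (fun _ _ h _ hx => ⟨hx.1, (hr_mono.monotone h).trans_lt hx.2⟩)
      ⟨0, (distrib_lt_top hg _).ne⟩
    rw [hset]
    exact ge_of_tendsto' hlim fun n => (lt_distrib_of_lt_rearr (hr_lt n).2).le

lemma decreasingRank_le_iff {g : ℝ → ℝ≥0∞} (hgm : Measurable g) (hg : distrib g 0 < ∞)
    (t x : ℝ) : decreasingRank g x ≤ ENNReal.ofReal t ↔
      rearr g t < g x ∨ g x = rearr g t ∧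
        volume ({y : ℝ | y ∈ Ioi (0 : ℝ) ∧ g y = rearr g t} ∩ Iic x) ≤
          ENNReal.ofReal t - distrib g (rearr g t) := by
  rcases lt_trichotomy (g x) (rearr g t) with h | h | h
  · have h1 := (lt_distrib_of_lt_rearr h).trans_le (distrib_le_decreasingRank g x)
    simp [h1.not_ge, h.not_gt, h.ne]
  · have hset : {y : ℝ | y ∈ Ioi (0 : ℝ) ∧ (g x < g y ∨ g y = g x ∧ y ≤ x)} =
        {y : ℝ | y ∈ Ioi (0 : ℝ) ∧ rearr g t < g y} ∪
          ({y : ℝ | y ∈ Ioi (0 : ℝ) ∧ g y = rearr g t} ∩ Iic x) := by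
      ext y
      simp only [h, mem_ofPred_eq, mem_union, mem_inter_iff, mem_Iic]
      tauto
    have hdisj : Disjoint {y : ℝ | y ∈ Ioi (0 : ℝ) ∧ rearr g t < g y}
        ({y : ℝ | y ∈ Ioi (0 : ℝ) ∧ g y = rearr g t} ∩ Iic x) :=
      disjoint_left.2 fun y hy hy' => hy.2.ne' hy'.1.2
    have hmeas : MeasurableSet ({y : ℝ | y ∈ Ioi (0 : ℝ) ∧ g y = rearr g t} ∩ Iic x) :=
      (measurableSet_Ioi.inter (hgm (measurableSet_singleton _))).inter measurableSet_Iic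
    have hfin : distrib g (rearr g t) ≠ ∞ := (distrib_lt_top hg _).ne
    have hle := distrib_rearr_le g t
    rw [decreasingRank, hset, measure_union hdisj hmeas]
    simp only [h, lt_self_iff_false, false_or, true_and]
    exact ((ENNReal.cancel_of_ne hfin).le_tsub_iff_left hle).symm
  · simp only [h, true_or, iff_true]
    refine (measure_mono ?_).trans (distrib_rearr_le g t)
    rintro y ⟨hy0, hy | hy⟩
    · exact ⟨hy0, h.trans hy⟩
    · exact ⟨hy0, hy.1 ▸ h⟩

lemma toReal_decreasingRank_preimage_Iic {g : ℝ → ℝ≥0∞} (hgm : Measurable g)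
    (hg : distrib g 0 < ∞) {t : ℝ} (ht : 0 ≤ t) :
    (fun x => (decreasingRank g x).toReal) ⁻¹' Iic t =
      {x | rearr g t < g x} ∪ ({x | g x = rearr g t} ∩
        {x | volume ({y : ℝ | y ∈ Ioi (0 : ℝ) ∧ g y = rearr g t} ∩ Iic x) ≤
          ENNReal.ofReal t - distrib g (rearr g t)}) := by
  ext x
  rw [mem_preimage, mem_Iic, ← ENNReal.le_ofReal_iff_toReal_le (decreasingRank_lt_top hg x).ne ht,
    decreasingRank_le_iff hgm hg]
  rfl

lemma measurableSet_volume_inter_Iic_le (F : Set ℝ) (a : ℝ≥0∞) :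
    MeasurableSet {x : ℝ | volume (F ∩ Iic x) ≤ a} := by
  have hmono : Monotone fun x => volume (F ∩ Iic x) := fun _ _ h =>
    measure_mono (inter_subset_inter_right _ (Iic_subset_Iic.2 h))
  exact measurableSet_le hmono.measurable measurable_const

lemma measurable_toReal_decreasingRank {g : ℝ → ℝ≥0∞} (hgm : Measurable g)
    (hg : distrib g 0 < ∞) : Measurable fun x => (decreasingRank g x).toReal := by
  refine measurable_of_Iic fun t => ?_
  rcases lt_or_ge t 0 with ht | ht
  · convert MeasurableSet.empty
    ext x
    simpa using ht.trans_le ENNReal.toReal_nonneg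
  · rw [toReal_decreasingRank_preimage_Iic hgm hg ht]
    exact (measurableSet_lt measurable_const hgm).union
      ((hgm (measurableSet_singleton _)).inter (measurableSet_volume_inter_Iic_le _ _))

lemma volume_toReal_decreasingRank_le {g : ℝ → ℝ≥0∞} (hgm : Measurable g)
    (hg : distrib g 0 < ∞) {t : ℝ} (ht : 0 ≤ t) :
    volume.restrict (Ioi (0 : ℝ)) ((fun x => (decreasingRank g x).toReal) ⁻¹' Iic t) =
      ENNReal.ofReal t := by
  rw [Measure.restrict_apply (measurable_toReal_decreasingRank hgm hg measurableSet_Iic),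
    toReal_decreasingRank_preimage_Iic hgm hg ht]
  have hfin : distrib g (rearr g t) ≠ ∞ := (distrib_lt_top hg _).ne
  have hsplit : ({x | rearr g t < g x} ∪ ({x | g x = rearr g t} ∩
        {x | volume ({y : ℝ | y ∈ Ioi (0 : ℝ) ∧ g y = rearr g t} ∩ Iic x) ≤
          ENNReal.ofReal t - distrib g (rearr g t)})) ∩ Ioi 0 =
      {x : ℝ | x ∈ Ioi (0 : ℝ) ∧ rearr g t < g x} ∪
        ({x : ℝ | x ∈ Ioi (0 : ℝ) ∧ g x = rearr g t} ∩
        {x | volume ({y : ℝ | y ∈ Ioi (0 : ℝ) ∧ g y = rearr g t} ∩ Iic x) ≤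
          ENNReal.ofReal t - distrib g (rearr g t)}) := by
    ext x
    simp only [mem_ofPred_eq, mem_union, mem_inter_iff]
    tauto
  have hFm : MeasurableSet {x : ℝ | x ∈ Ioi (0 : ℝ) ∧ g x = rearr g t} :=
    measurableSet_Ioi.inter (hgm (measurableSet_singleton _))
  have hge : ENNReal.ofReal t - distrib g (rearr g t) ≤
      volume {x : ℝ | x ∈ Ioi (0 : ℝ) ∧ g x = rearr g t} := by
    rw [tsub_le_iff_left]
    refine (ofReal_le_volume_rearr_le hgm hg t).trans
      ((measure_mono fun x hx => ?_).trans (measure_union_le _ _))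
    rcases hx.2.lt_or_eq with h | h
    · exact Or.inl ⟨hx.1, h⟩
    · exact Or.inr ⟨hx.1, h.symm⟩
  rw [hsplit, measure_union (disjoint_left.2 fun y hy hy' => hy.2.ne' hy'.1.2)
    (hFm.inter (measurableSet_volume_inter_Iic_le _ _)),
    volume_inter_initial (fun x hx => hx.1) hge]
  exact add_tsub_cancel_of_le (distrib_rearr_le g t)

lemma measurePreserving_toReal_decreasingRank {g : ℝ → ℝ≥0∞} (hgm : Measurable g)
    (hg : distrib g 0 < ∞) :
    MeasurePreserving (fun x => (decreasingRank g x).toReal)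
      (volume.restrict (Ioi (0 : ℝ))) (volume.restrict (Ioi (0 : ℝ))) := by
  have hm := measurable_toReal_decreasingRank hgm hg
  refine ⟨hm, ?_⟩
  have hIic : ∀ t : ℝ, volume.restrict (Ioi (0 : ℝ)) (Iic t) = ENNReal.ofReal t := by
    intro t
    rw [Measure.restrict_apply measurableSet_Iic, inter_comm, Ioi_inter_Iic, Real.volume_Ioc,
      sub_zero]
  have hmap : ∀ t : ℝ, (volume.restrict (Ioi (0 : ℝ))).map
      (fun x => (decreasingRank g x).toReal) (Iic t) = ENNReal.ofReal t := by
    intro t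
    rw [Measure.map_apply hm measurableSet_Iic]
    rcases lt_or_ge t 0 with ht | ht
    · have : (fun x => (decreasingRank g x).toReal) ⁻¹' Iic t = ∅ := by
        ext x
        simpa using ht.trans_le ENNReal.toReal_nonneg
      rw [this, measure_empty, ENNReal.ofReal_of_nonpos ht.le]
    · exact volume_toReal_decreasingRank_le hgm hg ht
  refine (Measure.ext_of_Ioc _ _ fun a b hab => ?_).symm
  rw [← Iic_sdiff_Iic, measure_sdiff (Iic_subset_Iic.2 hab.le) measurableSet_Iic.nullMeasurableSet
      (by simp [hIic]), measure_sdiff (Iic_subset_Iic.2 hab.le)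
      measurableSet_Iic.nullMeasurableSet (by simp [hmap]), hIic, hIic, hmap, hmap]

lemma rearr_toReal_decreasingRank_le {g : ℝ → ℝ≥0∞} (hg : distrib g 0 < ∞) (x : ℝ) :
    rearr g (decreasingRank g x).toReal ≤ g x := by
  refine rearr_le_of_distrib_le ?_
  rw [ENNReal.ofReal_toReal (decreasingRank_lt_top hg x).ne]
  exact distrib_le_decreasingRank g x

lemma distrib_eq_restrict (f : ℝ → ℝ≥0∞) (hf : Measurable f) (s : ℝ≥0∞) :
    distrib f s = volume.restrict (Ioi (0 : ℝ)) {t | s < f t} := by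
  rw [Measure.restrict_apply (measurableSet_lt measurable_const hf), inter_comm]
  rfl

/-- Hölder's inequality for a norm and its associate norm. -/
lemma lintegral_mul_le_assocNorm_mul (Y : RIBanachFunctionNorm) {u g : ℝ → ℝ≥0∞}
    (hu : Measurable u) (hg : assocNorm Y g ≤ 1) :
    ∫⁻ t in Ioi (0 : ℝ), g t * u t ≤ Y.N u := by
  rcases eq_or_ne (Y.N u) 0 with h0 | h0
  · have hz := (Y.eq_zero_iff u hu).1 h0
    rw [h0, lintegral_congr_ae (g := 0) (hz.mono fun t ht => by simp [ht])]
    simp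
  rcases eq_or_ne (Y.N u) ∞ with htop | htop
  · simp [htop]
  have hinv : (((Y.N u)⁻¹.toNNReal : ℝ≥0) : ℝ≥0∞) = (Y.N u)⁻¹ :=
    ENNReal.coe_toNNReal (ENNReal.inv_ne_top.2 h0)
  have hN : Y.N (fun t => (((Y.N u)⁻¹.toNNReal : ℝ≥0) : ℝ≥0∞) * u t) ≤ 1 := by
    rw [Y.smul _ u hu, hinv, ENNReal.inv_mul_cancel h0 htop]
  have h1 : ∫⁻ t in Ioi (0 : ℝ), g t * ((((Y.N u)⁻¹.toNNReal : ℝ≥0) : ℝ≥0∞) * u t) ≤ 1 :=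
    le_trans (le_iSup₂_of_le (fun t => (((Y.N u)⁻¹.toNNReal : ℝ≥0) : ℝ≥0∞) * u t)
      (hu.const_mul _) (le_iSup (fun _ => ∫⁻ t in Ioi (0 : ℝ),
        g t * ((((Y.N u)⁻¹.toNNReal : ℝ≥0) : ℝ≥0∞) * u t)) hN)) hg
  simp_rw [hinv, mul_left_comm (g _)] at h1
  rw [lintegral_const_mul' _ _ (ENNReal.inv_ne_top.2 h0), mul_comm, ← div_eq_mul_inv] at h1
  simpa using (ENNReal.div_le_iff h0 htop).1 h1

lemma lintegral_mul_rearr_le_of_distrib_lt_top (Y : RIBanachFunctionNorm) {u g : ℝ → ℝ≥0∞}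
    (hu : Measurable u) (hgm : Measurable g) (hg : assocNorm Y g ≤ 1) (hfin : distrib g 0 < ∞) :
    ∫⁻ t in Ioi (0 : ℝ), u t * rearr g t ≤ Y.N u := by
  set σ := fun x => (decreasingRank g x).toReal
  have hσ : MeasurePreserving σ (volume.restrict (Ioi (0 : ℝ))) (volume.restrict (Ioi (0 : ℝ))) :=
    measurePreserving_toReal_decreasingRank hgm hfin
  have huσ : Measurable (u ∘ σ) := hu.comp hσ.measurable
  calc ∫⁻ t in Ioi (0 : ℝ), u t * rearr g t
      = ∫⁻ x in Ioi (0 : ℝ), u (σ x) * rearr g (σ x) :=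
        (hσ.lintegral_comp (hu.mul (rearr_anti g).measurable)).symm
    _ ≤ ∫⁻ x in Ioi (0 : ℝ), g x * (u ∘ σ) x := lintegral_mono fun x => by
        rw [mul_comm]
        exact mul_le_mul_left (rearr_toReal_decreasingRank_le hfin x) _
    _ ≤ Y.N (u ∘ σ) := lintegral_mul_le_assocNorm_mul Y huσ hg
    _ = Y.N u := Y.ri _ _ huσ hu fun s => by
        rw [distrib_eq_restrict _ huσ, distrib_eq_restrict _ hu,
          ← hσ.measure_preimage (measurableSet_lt measurable_const hu).nullMeasurableSet]
        rfl

lemma assocNorm_mono (Y : RIBanachFunctionNorm) {f g : ℝ → ℝ≥0∞} (h : f ≤ g) :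
    assocNorm Y f ≤ assocNorm Y g :=
  iSup₂_mono fun _ _ => iSup_mono fun _ => lintegral_mono fun t => mul_le_mul_left (h t) _

/-- `‖g*‖_{Y'} ≤ 1` whenever `‖g‖_{Y'} ≤ 1`, in the form of Hölder's inequality. -/
lemma lintegral_mul_rearr_le (Y : RIBanachFunctionNorm) {u g : ℝ → ℝ≥0∞}
    (hu : Measurable u) (hgm : Measurable g) (hg : assocNorm Y g ≤ 1) :
    ∫⁻ t in Ioi (0 : ℝ), u t * rearr g t ≤ Y.N u := by
  set G : ℕ → ℝ → ℝ≥0∞ := fun n => (Iic (n : ℝ)).indicator g with hG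
  have hGle : ∀ n, G n ≤ g := fun n => indicator_le_self _ _
  have hGm : ∀ n, Measurable (G n) := fun n => hgm.indicator measurableSet_Iic
  have hGmono : Monotone G := fun m n h =>
    indicator_le_indicator_of_subset (Iic_subset_Iic.2 (Nat.cast_le.2 h)) fun _ => zero_le
  have hGfin : ∀ n, distrib (G n) 0 < ∞ := fun n => by
    refine (measure_mono (t := Ioc 0 (n : ℝ)) fun x hx => ⟨hx.1, ?_⟩).trans_lt measure_Ioc_lt_top
    exact mem_of_indicator_ne_zero (s := Iic (n : ℝ)) (f := g) (pos_iff_ne_zero.1 hx.2)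
  have hdmono : ∀ {f h : ℝ → ℝ≥0∞}, f ≤ h → ∀ s, distrib f s ≤ distrib h s := fun hfh s =>
    measure_mono fun x hx => ⟨hx.1, hx.2.trans_le (hfh x)⟩
  have hrmono : Monotone fun n => rearr (G n) := fun m n h t =>
    sInf_le_sInf fun s hs => (hdmono (hGmono h) s).trans hs
  have hsup : ∀ t, rearr g t ≤ ⨆ n, rearr (G n) t := by
    intro t
    refine rearr_le_of_distrib_le ?_
    have hset : ∀ s, {x : ℝ | x ∈ Ioi (0 : ℝ) ∧ s < g x} =
        ⋃ n, {x : ℝ | x ∈ Ioi (0 : ℝ) ∧ s < G n x} := by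
      intro s
      ext x
      simp only [mem_ofPred_eq, mem_iUnion]
      constructor
      · rintro ⟨hx0, hx⟩
        obtain ⟨n, hn⟩ := exists_nat_ge x
        exact ⟨n, hx0, by simpa [hG, hn] using hx⟩
      · rintro ⟨n, hx0, hx⟩
        exact ⟨hx0, hx.trans_le (hGle n x)⟩
    have hmono : ∀ s, Monotone fun n => {x : ℝ | x ∈ Ioi (0 : ℝ) ∧ s < G n x} :=
      fun s _ _ h x hx => ⟨hx.1, hx.2.trans_le (hGmono h x)⟩
    rw [distrib, hset, (hmono _).measure_iUnion]
    exact iSup_le fun n => (distrib_anti _ (le_iSup (fun n => rearr (G n) t) n)).trans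
      (distrib_rearr_le _ _)
  calc ∫⁻ t in Ioi (0 : ℝ), u t * rearr g t
      ≤ ∫⁻ t in Ioi (0 : ℝ), ⨆ n, u t * rearr (G n) t := lintegral_mono fun t => by
        simp_rw [← ENNReal.mul_iSup]
        exact mul_le_mul_right (hsup t) _
    _ = ⨆ n, ∫⁻ t in Ioi (0 : ℝ), u t * rearr (G n) t :=
        lintegral_iSup (fun n => hu.mul (rearr_anti _).measurable)
          fun m n h t => mul_le_mul_right (hrmono h t) _
    _ ≤ Y.N u := iSup_le fun n => lintegral_mul_rearr_le_of_distrib_lt_top Y hu (hGm n)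
        ((assocNorm_mono Y (hGle n)).trans hg) (hGfin n)

/-- The closed ball of radius `c` of `Y`, as a subset of `L²(0,∞)`. -/
def ballL2 (Y : RIBanachFunctionNorm) (c : ℝ≥0∞) :
    Set (Lp ℝ 2 (volume.restrict (Ioi (0 : ℝ)))) :=
  {v | Y.N (fun t => ‖v t‖ₑ) ≤ c}

lemma measurable_enorm_Lp (v : Lp ℝ 2 (volume.restrict (Ioi (0 : ℝ)))) :
    Measurable fun t => ‖v t‖ₑ :=
  (Lp.stronglyMeasurable v).enorm

lemma N_congr (Y : RIBanachFunctionNorm) {f g : ℝ → ℝ≥0∞} (hf : Measurable f) (hg : Measurable g)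
    (h : f =ᵐ[volume.restrict (Ioi (0 : ℝ))] g) : Y.N f = Y.N g :=
  le_antisymm (Y.mono f g hf hg h.le) (Y.mono g f hg hf h.symm.le)

lemma convex_ballL2 (Y : RIBanachFunctionNorm) (c : ℝ≥0∞) : Convex ℝ (ballL2 Y c) := by
  intro v hv w hw a b ha hb hab
  have hvm := measurable_enorm_Lp v
  have hwm := measurable_enorm_Lp w
  have hle : ∀ᵐ t ∂(volume.restrict (Ioi (0 : ℝ))), ‖(a • v + b • w) t‖ₑ ≤
      (a.toNNReal : ℝ≥0∞) * ‖v t‖ₑ + (b.toNNReal : ℝ≥0∞) * ‖w t‖ₑ := by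
    filter_upwards [Lp.coeFn_add (a • v) (b • w), Lp.coeFn_smul a v, Lp.coeFn_smul b w]
      with t h1 h2 h3
    rw [h1, Pi.add_apply, h2, h3, Pi.smul_apply, Pi.smul_apply]
    refine (enorm_add_le _ _).trans_eq ?_
    rw [enorm_smul, enorm_smul, Real.enorm_of_nonneg ha, Real.enorm_of_nonneg hb]
    rfl
  calc Y.N (fun t => ‖(a • v + b • w) t‖ₑ)
      ≤ Y.N (fun t => (a.toNNReal : ℝ≥0∞) * ‖v t‖ₑ + (b.toNNReal : ℝ≥0∞) * ‖w t‖ₑ) :=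
        Y.mono _ _ (measurable_enorm_Lp _) ((hvm.const_mul _).add (hwm.const_mul _)) hle
    _ ≤ a.toNNReal * Y.N (fun t => ‖v t‖ₑ) + b.toNNReal * Y.N (fun t => ‖w t‖ₑ) := by
        rw [← Y.smul _ _ hvm, ← Y.smul _ _ hwm]
        exact Y.add_le _ _ (hvm.const_mul _) (hwm.const_mul _)
    _ ≤ a.toNNReal * c + b.toNNReal * c := by gcongr; exacts [hv, hw]
    _ = c := by
        rw [← add_mul, ← ENNReal.coe_add, ← Real.toNNReal_add ha hb, hab, Real.toNNReal_one,
          ENNReal.coe_one, one_mul]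

lemma isClosed_ballL2 (Y : RIBanachFunctionNorm) (c : ℝ≥0∞) : IsClosed (ballL2 Y c) := by
  refine IsSeqClosed.isClosed fun w v hw hlim => ?_
  obtain ⟨ns, -, hns⟩ := (tendstoInMeasure_of_tendsto_Lp hlim).exists_seq_tendsto_ae
  have hm : ∀ n, Measurable fun t => ⨅ k ≥ n, ‖w (ns k) t‖ₑ := fun n =>
    Measurable.iInf fun k => Measurable.iInf fun _ => measurable_enorm_Lp _
  have hsup : ∀ᵐ t ∂(volume.restrict (Ioi (0 : ℝ))),
      ‖v t‖ₑ = ⨆ n, ⨅ k ≥ n, ‖w (ns k) t‖ₑ := by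
    filter_upwards [hns] with t ht
    rw [← liminf_eq_iSup_iInf_of_nat]
    exact (ht.enorm.liminf_eq).symm
  have hfatou := Y.fatou (fun n t => ⨅ k ≥ n, ‖w (ns k) t‖ₑ) (fun t => ‖v t‖ₑ) hm
    (measurable_enorm_Lp v)
    (Eventually.of_forall fun t m n h => le_iInf₂ fun k hk => iInf₂_le k (h.trans hk)) hsup
  change Y.N (fun t => ‖v t‖ₑ) ≤ c
  rw [hfatou]
  refine iSup_le fun n => le_trans ?_ (hw (ns n))
  exact Y.mono _ _ (hm n) (measurable_enorm_Lp _)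
    (Eventually.of_forall fun t => iInf₂_le n le_rfl)

/-- The truncations of `u` to bounded functions with bounded support. -/
def truncate (u : ℝ → ℝ≥0∞) (n : ℕ) : ℝ → ℝ≥0∞ :=
  (Iic (n : ℝ)).indicator fun t => min (u t) n

lemma measurable_truncate {u : ℝ → ℝ≥0∞} (hu : Measurable u) (n : ℕ) :
    Measurable (truncate u n) :=
  (hu.min measurable_const).indicator measurableSet_Iic

lemma truncate_le (u : ℝ → ℝ≥0∞) (n : ℕ) : truncate u n ≤ u :=
  (indicator_le_self _ _).trans fun _ => min_le_left _ _

lemma truncate_le_natCast (u : ℝ → ℝ≥0∞) (n : ℕ) (t : ℝ) : truncate u n t ≤ n :=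
  (indicator_le_self _ _ t).trans (min_le_right _ _)

lemma truncate_ne_top (u : ℝ → ℝ≥0∞) (n : ℕ) (t : ℝ) : truncate u n t ≠ ∞ :=
  ((truncate_le_natCast u n t).trans_lt (ENNReal.natCast_lt_top n)).ne

lemma monotone_truncate (u : ℝ → ℝ≥0∞) : Monotone (truncate u) := fun m n h t => by
  refine (indicator_le_indicator_of_subset (Iic_subset_Iic.2 (Nat.cast_le.2 h))
    (fun _ => zero_le) t).trans (indicator_le_indicator ?_)
  gcongr

lemma iSup_truncate (u : ℝ → ℝ≥0∞) (t : ℝ) : ⨆ n, truncate u n t = u t := by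
  refine le_antisymm (iSup_le fun n => truncate_le u n t) (le_of_forall_lt fun c hc => ?_)
  obtain ⟨n, hn⟩ := ENNReal.exists_nat_gt (ne_top_of_lt hc)
  obtain ⟨k, hk⟩ := exists_nat_ge t
  refine lt_of_lt_of_le (lt_min hc hn) (le_iSup_of_le (max n k) ?_)
  have ht : t ∈ Iic ((max n k : ℕ) : ℝ) := hk.trans (Nat.cast_le.2 (le_max_right _ _))
  rw [truncate, indicator_of_mem ht]
  gcongr
  exact le_max_left _ _

lemma N_eq_iSup_truncate (Y : RIBanachFunctionNorm) {u : ℝ → ℝ≥0∞} (hu : Measurable u) :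
    Y.N u = ⨆ n, Y.N (truncate u n) :=
  Y.fatou (truncate u) u (measurable_truncate hu) hu
    (Eventually.of_forall fun t _ _ h => monotone_truncate u h t)
    (Eventually.of_forall fun t => (iSup_truncate u t).symm)

lemma memLp_mul_truncate {ε : ℝ → ℝ} (hεm : Measurable ε) (hε : ∀ t, |ε t| ≤ 1)
    {u : ℝ → ℝ≥0∞} (hu : Measurable u) (n : ℕ) :
    MemLp (fun t => ε t * (truncate u n t).toReal) 2 (volume.restrict (Ioi (0 : ℝ))) := by
  have hbound : MemLp ((Iic (n : ℝ)).indicator fun _ => (n : ℝ)) 2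
      (volume.restrict (Ioi (0 : ℝ))) := by
    refine memLp_indicator_const 2 measurableSet_Iic (n : ℝ) (Or.inr ?_)
    rw [Measure.restrict_apply measurableSet_Iic, inter_comm, Ioi_inter_Iic]
    exact measure_Ioc_lt_top.ne
  refine hbound.mono (hεm.mul (measurable_truncate hu n).ennreal_toReal).aestronglyMeasurable
    (Eventually.of_forall fun t => ?_)
  by_cases ht : t ∈ Iic (n : ℝ)
  · rw [indicator_of_mem ht, norm_mul, Real.norm_eq_abs, Real.norm_eq_abs, Real.norm_eq_abs,
      abs_of_nonneg ENNReal.toReal_nonneg, Nat.abs_cast]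
    have h1 : (truncate u n t).toReal ≤ n := by
      simpa using ENNReal.toReal_mono (ENNReal.natCast_ne_top n) (truncate_le_natCast u n t)
    exact (mul_le_of_le_one_left ENNReal.toReal_nonneg (hε t)).trans h1
  · simp [truncate, indicator_of_notMem ht]

lemma exists_lt_lintegral_mul_truncate (Y : RIBanachFunctionNorm) {u : ℝ → ℝ≥0∞}
    (hu : Measurable u) (n : ℕ) {c : ℝ≥0∞} (hc : c < Y.N (truncate u n)) :
    ∃ g : ℝ → ℝ≥0∞, Measurable g ∧ assocNorm Y g ≤ 1 ∧
      c ≤ ∫⁻ t in Ioi (0 : ℝ), truncate u n t * g t := by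
  rcases eq_or_ne c 0 with rfl | hc0
  · refine ⟨0, measurable_zero, ?_, zero_le⟩
    simp [assocNorm]
  have hctop : c ≠ ∞ := ne_top_of_lt hc
  have hLp := memLp_mul_truncate measurable_one (by simp) hu n
  set x : Lp ℝ 2 (volume.restrict (Ioi (0 : ℝ))) := hLp.toLp with hx
  have hxae : x =ᵐ[volume.restrict (Ioi (0 : ℝ))] fun t => (truncate u n t).toReal :=
    hLp.coeFn_toLp.trans (Eventually.of_forall fun t => by simp)
  have hxN : Y.N (fun t => ‖x t‖ₑ) = Y.N (truncate u n) := by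
    refine N_congr Y (measurable_enorm_Lp x) (measurable_truncate hu n) ?_
    filter_upwards [hxae] with t ht
    rw [ht, Real.enorm_of_nonneg ENNReal.toReal_nonneg, ENNReal.ofReal_toReal
      (truncate_ne_top u n t)]
  have hxS : x ∉ ballL2 Y c := fun h => (hc.trans_le (hxN ▸ h)).false
  obtain ⟨ℓ, γ, hℓ, hγ⟩ :=
    geometric_hahn_banach_closed_point (convex_ballL2 Y c) (isClosed_ballL2 Y c) hxS
  obtain ⟨φ, rfl⟩ := (InnerProductSpace.toDual ℝ _).surjective ℓ
  simp only [InnerProductSpace.toDual_apply_apply, L2.inner_def, RCLike.inner_apply,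
    conj_trivial] at hℓ hγ
  have hφm : Measurable φ := (Lp.stronglyMeasurable φ).measurable
  have hφe := measurable_enorm_Lp φ
  have h0S : (0 : Lp ℝ 2 (volume.restrict (Ioi (0 : ℝ)))) ∈ ballL2 Y c := by
    have : Y.N (fun t => ‖(0 : Lp ℝ 2 (volume.restrict (Ioi (0 : ℝ)))) t‖ₑ) = 0 := by
      rw [Y.eq_zero_iff _ (measurable_enorm_Lp 0)]
      filter_upwards [Lp.coeFn_zero ℝ 2 (volume.restrict (Ioi (0 : ℝ)))] with t ht
      rw [ht, Pi.zero_apply, enorm_zero]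
    exact this.trans_le zero_le
  have hγ0 : 0 < γ := by
    refine lt_of_le_of_lt (le_of_eq ?_) (hℓ 0 h0S)
    refine (integral_eq_zero_of_ae ?_).symm
    filter_upwards [Lp.coeFn_zero ℝ 2 (volume.restrict (Ioi (0 : ℝ)))] with t ht
    rw [ht, Pi.zero_apply, zero_mul]
  have hint : ∀ v : Lp ℝ 2 (volume.restrict (Ioi (0 : ℝ))),
      Integrable (fun t => v t * φ t) (volume.restrict (Ioi (0 : ℝ))) := fun v =>
    (Lp.memLp v).integrable_mul (Lp.memLp φ)
  have hupper : ∀ w : ℝ → ℝ≥0∞, Measurable w → Y.N w ≤ c →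
      ∫⁻ t in Ioi (0 : ℝ), ‖φ t‖ₑ * w t ≤ ENNReal.ofReal γ := by
    intro w hw hwN
    simp_rw [← iSup_truncate w, ENNReal.mul_iSup]
    rw [lintegral_iSup (f := fun k t => ‖φ t‖ₑ * truncate w k t)
      (fun k => hφe.mul (measurable_truncate hw k))
      fun _ _ h t => mul_le_mul_right (monotone_truncate w h t) _]
    refine iSup_le fun k => ?_
    have hsm : Measurable fun t => (SignType.sign (φ t) : ℝ) := by
      have : Measurable fun r : ℝ => (SignType.sign r : ℝ) := by
        have hcoe : ∀ p q : SignType, p ≤ q → (p : ℝ) ≤ q := by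
          intro p q h
          cases p <;> cases q <;> first | exact absurd h (by decide) | norm_num
        exact Monotone.measurable fun a b hab => hcoe _ _ (SignType.sign.monotone hab)
      exact this.comp hφm
    have hs1 : ∀ t, |(SignType.sign (φ t) : ℝ)| ≤ 1 := fun t => by
      cases SignType.sign (φ t) <;> simp
    have hLpv := memLp_mul_truncate hsm hs1 hw k
    set v : Lp ℝ 2 (volume.restrict (Ioi (0 : ℝ))) := hLpv.toLp with hv
    have hvae := hLpv.coeFn_toLp
    have hvS : v ∈ ballL2 Y c := by
      refine le_trans (Y.mono _ _ (measurable_enorm_Lp v) hw ?_) hwN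
      filter_upwards [hvae] with t ht
      rw [hv, ht, enorm_mul, Real.enorm_of_nonneg ENNReal.toReal_nonneg, ENNReal.ofReal_toReal
        (truncate_ne_top w k t)]
      refine (mul_le_of_le_one_left zero_le ?_).trans (truncate_le w k t)
      rw [Real.enorm_eq_ofReal_abs]
      exact ENNReal.ofReal_le_one.2 (hs1 t)
    have hprod : ∀ᵐ t ∂(volume.restrict (Ioi (0 : ℝ))),
        v t * φ t = |φ t| * (truncate w k t).toReal := by
      filter_upwards [hvae] with t ht
      rw [hv, ht, mul_right_comm, sign_mul_self]
    calc ∫⁻ t in Ioi (0 : ℝ), ‖φ t‖ₑ * truncate w k t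
        = ∫⁻ t in Ioi (0 : ℝ), ENNReal.ofReal (v t * φ t) := by
          refine lintegral_congr_ae (hprod.mono fun t ht => ?_)
          simp only [ht]
          rw [ENNReal.ofReal_mul (abs_nonneg _), ENNReal.ofReal_toReal (truncate_ne_top w k t),
            Real.enorm_eq_ofReal_abs]
      _ = ENNReal.ofReal (∫ t in Ioi (0 : ℝ), v t * φ t) := by
          refine (ofReal_integral_eq_lintegral_ofReal (hint v) ?_).symm
          exact hprod.mono fun t ht =>
            (mul_nonneg (abs_nonneg _) ENNReal.toReal_nonneg).trans_eq ht.symm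
      _ ≤ ENNReal.ofReal γ := ENNReal.ofReal_le_ofReal (hℓ v hvS).le
  have hlower : ENNReal.ofReal γ ≤ ∫⁻ t in Ioi (0 : ℝ), truncate u n t * ‖φ t‖ₑ := by
    calc ENNReal.ofReal γ ≤ ENNReal.ofReal (∫ t in Ioi (0 : ℝ), ‖x t * φ t‖) :=
          ENNReal.ofReal_le_ofReal (hγ.le.trans ((Real.le_norm_self _).trans
            (norm_integral_le_integral_norm _)))
      _ = ∫⁻ t in Ioi (0 : ℝ), ‖x t * φ t‖ₑ := ofReal_integral_norm_eq_lintegral_enorm (hint x)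
      _ = ∫⁻ t in Ioi (0 : ℝ), truncate u n t * ‖φ t‖ₑ := by
          refine lintegral_congr_ae (hxae.mono fun t ht => ?_)
          simp only [enorm_mul]
          rw [ht, Real.enorm_of_nonneg ENNReal.toReal_nonneg, ENNReal.ofReal_toReal
            (truncate_ne_top u n t)]
  set d : ℝ≥0∞ := ENNReal.ofReal γ with hd
  have hd0 : d ≠ 0 := (ENNReal.ofReal_pos.2 hγ0).ne'
  have hdtop : d ≠ ∞ := ENNReal.ofReal_ne_top
  have hkey : ∀ w : ℝ → ℝ≥0∞, ∫⁻ t in Ioi (0 : ℝ), c / d * ‖φ t‖ₑ * w t =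
      d⁻¹ * ∫⁻ t in Ioi (0 : ℝ), ‖φ t‖ₑ * (c * w t) := by
    intro w
    rw [← lintegral_const_mul' _ _ (ENNReal.inv_ne_top.2 hd0)]
    refine lintegral_congr fun t => ?_
    rw [div_eq_mul_inv]
    ring
  refine ⟨fun t => c / d * ‖φ t‖ₑ, hφe.const_mul _, ?_, ?_⟩
  · refine iSup_le fun w => iSup₂_le fun hw hwN => ?_
    have hcw := Y.smul c.toNNReal w hw
    rw [ENNReal.coe_toNNReal hctop] at hcw
    rw [hkey]
    calc d⁻¹ * ∫⁻ t in Ioi (0 : ℝ), ‖φ t‖ₑ * (c * w t) ≤ d⁻¹ * d := by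
          gcongr
          exact hupper _ (hw.const_mul c) (hcw.trans_le (mul_le_of_le_one_right zero_le hwN))
      _ = 1 := ENNReal.inv_mul_cancel hd0 hdtop
  · calc c = c / d * d := (ENNReal.div_mul_cancel hd0 hdtop).symm
      _ ≤ c / d * ∫⁻ t in Ioi (0 : ℝ), truncate u n t * ‖φ t‖ₑ := by gcongr
      _ = ∫⁻ t in Ioi (0 : ℝ), truncate u n t * (c / d * ‖φ t‖ₑ) := by
          rw [← lintegral_const_mul' _ _ (ENNReal.div_ne_top hctop hd0)]
          exact lintegral_congr fun t => mul_left_comm _ _ _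

/-- The nontrivial inequality in the Lorentz–Luxemburg theorem `Y'' = Y`. -/
lemma N_le_iSup_lintegral_mul (Y : RIBanachFunctionNorm) {u : ℝ → ℝ≥0∞} (hu : Measurable u) :
    Y.N u ≤ ⨆ (g : ℝ → ℝ≥0∞) (_ : Measurable g) (_ : assocNorm Y g ≤ 1),
      ∫⁻ t in Ioi (0 : ℝ), u t * g t := by
  refine le_of_forall_lt fun c hc => ?_
  obtain ⟨c', hcc', hc'⟩ := exists_between hc
  rw [N_eq_iSup_truncate Y hu] at hc'
  obtain ⟨n, hn⟩ := lt_iSup_iff.1 hc'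
  obtain ⟨g, hgm, hg, hle⟩ := exists_lt_lintegral_mul_truncate Y hu n hn
  refine hcc'.trans_le (le_iSup₂_of_le g hgm (le_iSup_of_le hg (hle.trans ?_)))
  exact lintegral_mono fun t => mul_le_mul_left (truncate_le u n t) _

/-- `‖H_I^m f‖_Y = sup { ∫_0^∞ f · R_I^m g* : ‖g‖_{Y'} ≤ 1 }`. -/
theorem statement18 (m : ℕ) (hm : 1 ≤ m) (I : ℝ → ℝ)
    (hI : MonotoneOn I (Set.Ioi 0))
    (hIpos : ∀ t ∈ Set.Ioi (0 : ℝ), 0 < I t)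
    (Y : RIBanachFunctionNorm) (f : ℝ → ℝ≥0∞) (hf : Measurable f) :
    Y.N ((HI I)^[m] f) =
      ⨆ (g : ℝ → ℝ≥0∞) (_ : Measurable g) (_ : assocNorm Y g ≤ 1),
        ∫⁻ t in Set.Ioi (0 : ℝ), f t * (RI I)^[m] (rearr g) t := by
  simp_rw [lintegral_mul_RI_iterate hI hf (rearr_anti _).measurable m]
  have hh : Measurable ((HI I)^[m] f) := measurable_HI_iterate I hf m
  refine le_antisymm ((N_le_iSup_lintegral_mul Y hh).trans ?_) ?_
  · refine iSup₂_mono fun g hg => iSup_mono fun _ => ?_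
    obtain ⟨k, rfl⟩ := Nat.exists_eq_succ_of_ne_zero (Nat.one_le_iff_ne_zero.1 hm)
    rw [Function.iterate_succ_apply']
    exact lintegral_HI_mul_le hI (measurable_HI_iterate I hf k) hg
  · exact iSup₂_le fun g hg => iSup_le fun hgN => lintegral_mul_rearr_le Y hh hg hgN
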